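/- arXiv:1911.02861 — 2 statements merged into one kernel-verified Lean document; each statement's English description precedes it below -/
import Mathlib

section
/- Let σ be a facet. Then the set of affine roots vanishing at a point is constant along σ: for any two points p, p' ∈ σ one has Y_p = Y_{p'}. -/
open Set

/-- The set of affine roots `(r, n)` with `r ∈ R`, `n : ℤ`, vanishing at the point `x`,
i.e. such that `r x + n = 0`.  This is the set `Y_x`. -/
def affineRootsVanishingAt {V : Type*} [NormedAddCommGroup V] [NormedSpace ℝ V]
    (R : Finset (V →ₗ[ℝ] ℝ)) (x : V) : Set ((V →ₗ[ℝ] ℝ) × ℤ) :=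
  {α | α.1 ∈ R ∧ α.1 x + (α.2 : ℝ) = 0}

/-- `H_n`: the set of points where exactly `n` affine roots vanish. -/
def Hset {V : Type*} [NormedAddCommGroup V] [NormedSpace ℝ V]
    (R : Finset (V →ₗ[ℝ] ℝ)) (n : ℕ) : Set V :=
  {x | (affineRootsVanishingAt R x).ncard = n}

/-- A facet is a connected component of some `H_n`. -/
def IsFacet {V : Type*} [NormedAddCommGroup V] [NormedSpace ℝ V]
    (R : Finset (V →ₗ[ℝ] ℝ)) (σ : Set V) : Prop :=
  ∃ (n : ℕ) (x : V), x ∈ Hset R n ∧ σ = connectedComponentIn (Hset R n) x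

open Filter Topology

theorem finite_affineRootsVanishingAt {V : Type*} [NormedAddCommGroup V] [NormedSpace ℝ V]
    (R : Finset (V →ₗ[ℝ] ℝ)) (x : V) : (affineRootsVanishingAt R x).Finite := by
  refine Set.Finite.of_finite_image (f := Prod.fst) (R.finite_toSet.subset ?_) ?_
  · rintro _ ⟨α, hα, rfl⟩
    exact hα.1
  · rintro ⟨r, m⟩ ⟨_, hm⟩ ⟨r', m'⟩ ⟨_, hm'⟩ (rfl : r = r')
    have hcast : (m : ℝ) = m' := by
      dsimp only at hm hm'
      linarith
    rw [Int.cast_inj.mp hcast]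

/-- Affine roots not vanishing at `x` do not vanish near `x`, uniformly in the root. -/
theorem eventually_affineRootsVanishingAt_subset {V : Type*} [NormedAddCommGroup V]
    [NormedSpace ℝ V] [FiniteDimensional ℝ V] (R : Finset (V →ₗ[ℝ] ℝ)) (x : V) :
    ∀ᶠ y in 𝓝 x, affineRootsVanishingAt R y ⊆ affineRootsVanishingAt R x := by
  have hroot : ∀ r ∈ R, ∀ᶠ y in 𝓝 x, ∀ m : ℤ, r y + m = 0 → r x + m = 0 := by
    intro r _
    have hclosed : IsClosed ((fun m : ℤ => (m : ℝ)) '' {m | r x + m ≠ 0}) :=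
      Int.isClosedEmbedding_coe_real.isClosedMap _ (isClosed_discrete _)
    have hcont : Continuous fun y => -r y := r.continuous_of_finiteDimensional.neg
    have hx : -r x ∉ (fun m : ℤ => (m : ℝ)) '' {m | r x + m ≠ 0} := by
      rintro ⟨m, hm, hmx⟩
      dsimp only at hmx
      exact hm (by linarith)
    filter_upwards [hcont.continuousAt.eventually (hclosed.isOpen_compl.mem_nhds hx)]
      with y hy m hm
    by_contra hne
    exact hy ⟨m, hne, by dsimp only; linarith⟩
  filter_upwards [(Filter.eventually_all_finset R).mpr hroot] with y hy α hα
  exact ⟨hα.1, hy α.1 hα.1 α.2 hα.2⟩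

theorem eventually_affineRootsVanishingAt_eq {V : Type*} [NormedAddCommGroup V]
    [NormedSpace ℝ V] [FiniteDimensional ℝ V] (R : Finset (V →ₗ[ℝ] ℝ)) {n : ℕ} {x : V}
    (hx : x ∈ Hset R n) :
    ∀ᶠ y in 𝓝[Hset R n] x, affineRootsVanishingAt R y = affineRootsVanishingAt R x := by
  filter_upwards [(eventually_affineRootsVanishingAt_subset R x).filter_mono nhdsWithin_le_nhds,
    self_mem_nhdsWithin] with y hsub hy
  exact Set.eq_of_subset_of_ncard_le hsub (hx.trans hy.symm).le
    (finite_affineRootsVanishingAt R x)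

theorem vanishing_affine_roots_const_on_facet {V : Type*} [NormedAddCommGroup V] [NormedSpace ℝ V] [FiniteDimensional ℝ V]
    (R : Finset (V →ₗ[ℝ] ℝ)) (hR : ∀ r ∈ R, r ≠ 0)
    (σ : Set V) (hσ : IsFacet R σ) :
    ∀ p ∈ σ, ∀ p' ∈ σ, affineRootsVanishingAt R p = affineRootsVanishingAt R p' := by
  obtain ⟨n, x, -, rfl⟩ := hσ
  intro p hp p' hp'
  let _ : TopologicalSpace (Set ((V →ₗ[ℝ] ℝ) × ℤ)) := ⊥
  have : DiscreteTopology (Set ((V →ₗ[ℝ] ℝ) × ℤ)) := ⟨rfl⟩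
  have hcont : ContinuousOn (affineRootsVanishingAt R) (Hset R n) := fun y hy =>
    tendsto_const_nhds.congr' <|
      (eventually_affineRootsVanishingAt_eq R hy).mono fun _ h => h.symm
  exact isPreconnected_connectedComponentIn.constant
    (hcont.mono (connectedComponentIn_subset _ _)) hp hp'
end

section
/- Every facet is a convex subset of V: if p and p' lie in a facet σ, then the closed segment joining p and p' is contained in σ. -/
open Set

open Filter Topology

/-- The roots taking an integral value at `x`. -/
noncomputable def integralRoots {V : Type*} [NormedAddCommGroup V] [NormedSpace ℝ V]
    (R : Finset (V →ₗ[ℝ] ℝ)) (x : V) : Finset (V →ₗ[ℝ] ℝ) :=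
  open Classical in R.filter fun r => (⌊r x⌋ : ℝ) = r x

theorem mem_integralRoots {V : Type*} [NormedAddCommGroup V] [NormedSpace ℝ V]
    {R : Finset (V →ₗ[ℝ] ℝ)} {x : V} {r : V →ₗ[ℝ] ℝ} :
    r ∈ integralRoots R x ↔ r ∈ R ∧ (⌊r x⌋ : ℝ) = r x := by
  simp [integralRoots]

theorem ncard_affineRootsVanishingAt {V : Type*} [NormedAddCommGroup V] [NormedSpace ℝ V]
    (R : Finset (V →ₗ[ℝ] ℝ)) (x : V) :
    (affineRootsVanishingAt R x).ncard = (integralRoots R x).card := by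
  have h : affineRootsVanishingAt R x =
      (fun r : V →ₗ[ℝ] ℝ => (r, -⌊r x⌋)) '' (integralRoots R x : Set (V →ₗ[ℝ] ℝ)) := by
    ext ⟨r, n⟩
    simp only [affineRootsVanishingAt, mem_ofPred_eq, mem_image, Finset.mem_coe,
      mem_integralRoots, Prod.mk.injEq]
    constructor
    · rintro ⟨hr, hn⟩
      have hx : r x = ((-n : ℤ) : ℝ) := by push_cast; linarith
      exact ⟨r, ⟨hr, by rw [hx, Int.floor_intCast]⟩, rfl, by rw [hx, Int.floor_intCast]; ring⟩
    · rintro ⟨r, ⟨hr, hx⟩, rfl, rfl⟩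
      exact ⟨hr, by push_cast; linarith⟩
  rw [h, ncard_image_of_injective _ fun r s hrs => (Prod.mk.inj hrs).1, ncard_coe_finset]

theorem mem_Hset_iff {V : Type*} [NormedAddCommGroup V] [NormedSpace ℝ V]
    {R : Finset (V →ₗ[ℝ] ℝ)} {n : ℕ} {x : V} :
    x ∈ Hset R n ↔ (integralRoots R x).card = n := by
  rw [← ncard_affineRootsVanishingAt]; rfl

theorem floor_eq_self_iff_floor_eq_ceil (t : ℝ) : (⌊t⌋ : ℝ) = t ↔ ⌊t⌋ = ⌈t⌉ := by
  constructor
  · intro h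
    rw [← h, Int.floor_intCast, Int.ceil_intCast]
  · intro h
    refine le_antisymm (Int.floor_le t) ?_
    rw [h]
    exact Int.le_ceil t

theorem eventually_integral_imp_eq (t : ℝ) :
    ∀ᶠ s in 𝓝 t, ((⌊s⌋ : ℝ) = s → s = t) ∧
      ((⌊t⌋ : ℝ) ≠ t → ⌊s⌋ = ⌊t⌋ ∧ ⌈s⌉ = ⌈t⌉) := by
  by_cases ht : (⌊t⌋ : ℝ) = t
  · filter_upwards [Ioo_mem_nhds (sub_one_lt t) (lt_add_one t)] with s hs
    refine ⟨fun h => ?_, fun h => absurd ht h⟩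
    have h₁ := hs.1
    have h₂ := hs.2
    rw [← h, ← ht] at h₁ h₂ ⊢
    norm_cast at h₁ h₂ ⊢
    lia
  · have hlt : (⌊t⌋ : ℝ) < t := lt_of_le_of_ne (Int.floor_le t) ht
    filter_upwards [Ioo_mem_nhds hlt (Int.lt_floor_add_one t)] with s hs
    have hs' : ⌊s⌋ = ⌊t⌋ := Int.floor_eq_iff.2 ⟨hs.1.le, hs.2⟩
    refine ⟨fun h => ?_, fun _ => ⟨hs', ?_⟩⟩
    · rw [hs'] at h
      exact absurd h hs.1.ne
    · have hc : ∀ u : ℝ, (⌊t⌋ : ℝ) < u → u < ⌊t⌋ + 1 → ⌈u⌉ = ⌊t⌋ + 1 := fun u h₁ h₂ =>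
        Int.ceil_eq_iff.2 ⟨by push_cast; linarith, by push_cast; exact h₂.le⟩
      rw [hc s hs.1 hs.2, hc t hlt (Int.lt_floor_add_one t)]

theorem continuousOn_floor_ceil_Hset {V : Type*} [NormedAddCommGroup V] [NormedSpace ℝ V]
    [FiniteDimensional ℝ V] {R : Finset (V →ₗ[ℝ] ℝ)} (n : ℕ) {r : V →ₗ[ℝ] ℝ} (hr : r ∈ R) :
    ContinuousOn (fun x => (⌊r x⌋, ⌈r x⌉)) (Hset R n) := by
  intro x hx
  have hev : ∀ᶠ y in 𝓝 x, ∀ r ∈ R, ((⌊r y⌋ : ℝ) = r y → r y = r x) ∧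
      ((⌊r x⌋ : ℝ) ≠ r x → ⌊r y⌋ = ⌊r x⌋ ∧ ⌈r y⌉ = ⌈r x⌉) :=
    (eventually_all_finset R).2 fun r _ =>
      r.continuous_of_finiteDimensional.continuousAt.eventually
        (eventually_integral_imp_eq (r x))
  refine tendsto_const_nhds.congr' ?_
  filter_upwards [nhdsWithin_le_nhds hev, self_mem_nhdsWithin] with y hy hyn
  have hsub : integralRoots R y ⊆ integralRoots R x := fun s hs => by
    rw [mem_integralRoots] at hs ⊢
    exact ⟨hs.1, (hy s hs.1).1 hs.2 ▸ hs.2⟩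
  have heq := Finset.eq_of_subset_of_card_le hsub
    ((mem_Hset_iff.1 hx).trans (mem_Hset_iff.1 hyn).symm).le
  by_cases hrx : (⌊r x⌋ : ℝ) = r x
  · have hry : r ∈ integralRoots R y := heq ▸ mem_integralRoots.2 ⟨hr, hrx⟩
    rw [(hy r hr).1 (mem_integralRoots.1 hry).2]
  · rw [((hy r hr).2 hrx).1, ((hy r hr).2 hrx).2]

theorem Monotone.eq_of_mem_segment {α : Type*} [PartialOrder α] {f : ℝ → α} (hf : Monotone f)
    {s t u : ℝ} (h : f s = f t) (hu : u ∈ segment ℝ s t) : f u = f s := by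
  rw [segment_eq_uIcc, mem_uIcc] at hu
  rcases hu with hu | hu
  · exact le_antisymm (h ▸ hf hu.2) (hf hu.1)
  · exact le_antisymm (hf hu.2) (h ▸ hf hu.1)

theorem facet_convex {V : Type*} [NormedAddCommGroup V] [NormedSpace ℝ V] [FiniteDimensional ℝ V]
    (R : Finset (V →ₗ[ℝ] ℝ)) (hR : ∀ r ∈ R, r ≠ 0)
    (σ : Set V) (hσ : IsFacet R σ) :
    ∀ p ∈ σ, ∀ p' ∈ σ, segment ℝ p p' ⊆ σ := by
  obtain ⟨n, x, -, rfl⟩ := hσ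
  intro p hp p' hp'
  have hsub := connectedComponentIn_subset (Hset R n) x
  have hseg : segment ℝ p p' ⊆ Hset R n := by
    intro z hz
    rw [mem_Hset_iff, ← mem_Hset_iff.1 (hsub hp)]
    congr 1
    ext r
    rw [mem_integralRoots, mem_integralRoots]
    refine and_congr_right fun hr => ?_
    have hpp := isPreconnected_connectedComponentIn.constant
      ((continuousOn_floor_ceil_Hset n hr).mono hsub) hp hp'
    obtain ⟨hfl, hce⟩ := Prod.mk.inj hpp
    have hrz : r z ∈ segment ℝ (r p) (r p') :=
      image_segment ℝ r.toAffineMap p p' ▸ mem_image_of_mem r.toAffineMap hz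
    rw [floor_eq_self_iff_floor_eq_ceil, floor_eq_self_iff_floor_eq_ceil,
      Int.floor_mono.eq_of_mem_segment hfl hrz, Int.ceil_mono.eq_of_mem_segment hce hrz]
  rw [connectedComponentIn_eq hp]
  exact (convex_segment p p').isPreconnected.subset_connectedComponentIn
    (left_mem_segment ℝ p p') hseg
end
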